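/- arXiv:1602.03231 — 3 statements merged into one kernel-verified Lean document; each statement's English description precedes it below -/
import Mathlib

section
/- For any word v = v₁⋯v_n over A = {a,b} with n ≥ 0, |ψ(v)| = Σ_{i=1}^n |∂(a·ψ(v_i v_{i+1} ⋯ v_n)·b)|; that is, the length of the central word ψ(v) is the sum, over all suffixes v_i⋯v_n of v, of the lengths of the derivatives of the corresponding Christoffel words. -/
namespace Chri

/-- Length of the longest palindromic suffix of `w`. -/
def lpsLen (w : List Bool) : ℕ :=
  ((List.range (w.length + 1)).filter
    (fun l => w.drop (w.length - l) == (w.drop (w.length - l)).reverse)).foldr max 0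

/-- Right palindromic closure: the shortest palindrome having `w` as a prefix. -/
def palClosure (w : List Bool) : List Bool :=
  w ++ (w.take (w.length - lpsLen w)).reverse

/-- The iterated palindromization map ψ. -/
def psi (v : List Bool) : List Bool :=
  v.foldl (fun w x => palClosure (w ++ [x])) []

/-- Apply a substitution (morphism of the free monoid) letter by letter. -/
def applyM (f : Bool → List Bool) (w : List Bool) : List Bool := (w.map f).flatten

/-- μ_x : x ↦ x, y ↦ xy (a = false, b = true). -/
def muL (x : Bool) : List Bool → List Bool :=
  applyM (fun y => if y = x then [x] else [x, y])

/-- λ_a = μ_a; λ_b : a ↦ ab, b ↦ b. -/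
def lamL : Bool → List Bool → List Bool
  | false => applyM (fun y => if y = false then [false] else [false, true])
  | true  => applyM (fun y => if y = true then [true] else [false, true])

/-- μ_{v₁⋯v_n} = μ_{v₁} ∘ ⋯ ∘ μ_{v_n}. -/
def muW : List Bool → List Bool → List Bool
  | [], w => w
  | x :: v, w => muL x (muW v w)

/-- λ_{v₁⋯v_n} = λ_{v₁} ∘ ⋯ ∘ λ_{v_n}. -/
def lamW : List Bool → List Bool → List Bool
  | [], w => w
  | x :: v, w => lamL x (lamW v w)

/-- Christoffel words: the letters and the words aψ(v)b. -/
def IsChristoffel (w : List Bool) : Prop :=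
  w = [false] ∨ w = [true] ∨ ∃ v, w = false :: (psi v ++ [true])

/-- A word is constant if it is a power of a single letter. -/
def IsConstant (v : List Bool) : Prop := ∃ x n, v = List.replicate n x

/-- ₊v : the longest proper suffix of v immediately preceded by the complement of
the first letter of v. -/
def plusV (v : List Bool) : List Bool :=
  (v.dropWhile (fun y => y == v.headD false)).tail

/-- v₊ : the longest proper prefix of v immediately followed by the complement of
the last letter of v. -/
def vPlus (v : List Bool) : List Bool := (plusV v.reverse).reverse

/-- α₀: the length of the first maximal block of `v` (the index). -/
def blockLen (v : List Bool) : ℕ :=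
  (v.takeWhile (fun y => y == v.headD false)).length

/-- The list of lengths of the maximal blocks of equal letters of `v`
(the integral representation (α₀, …, α_n)). -/
def blockLens : List Bool → List ℕ
  | [] => []
  | [_] => [1]
  | x :: y :: v =>
    if x = y then
      match blockLens (y :: v) with
      | [] => [1]
      | n :: ns => (n + 1) :: ns
    else 1 :: blockLens (y :: v)

/-- ext(v) = number of maximal blocks of v. -/
def ext (v : List Bool) : ℕ := (blockLens v).length

/-- π(w): the minimal period of `w` (with π(ε) = 1). -/
noncomputable def minPeriod (w : List Bool) : ℕ :=
  sInf {p | 0 < p ∧ ∀ i, i + p < w.length → w.getD i false = w.getD (i + p) false}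

/-- φ_k : a ↦ a^{k+1} b, b ↦ a^k b. -/
def phi (k : ℕ) : List Bool → List Bool :=
  applyM (fun y => if y = false then List.replicate (k + 1) false ++ [true]
                   else List.replicate k false ++ [true])

/-- φ̂_k : a ↦ a b^k, b ↦ a b^{k+1}. -/
def phiHat (k : ℕ) : List Bool → List Bool :=
  applyM (fun y => if y = false then false :: List.replicate k true
                   else false :: List.replicate (k + 1) true)

attribute [local instance] Classical.propDecidable

/-- The derivative ∂w of a proper Christoffel word w = aψ(v)b of index k:
∂(ab) = a, and otherwise the preimage of w under φ_k (if v starts with a)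
or φ̂_k (if v starts with b). -/
noncomputable def derivC (w : List Bool) : List Bool :=
  if w = [false, true] then [false]
  else if h : ∃ v, v ≠ [] ∧ w = false :: (psi v ++ [true]) then
    if h.choose.headD false = false then Function.invFun (phi (blockLen h.choose)) w
    else Function.invFun (phiHat (blockLen h.choose)) w
  else w

/-- The depth of a Christoffel word: the least d with ∂^d w a single letter. -/
noncomputable def depth (w : List Bool) : ℕ :=
  sInf {d | derivC^[d] w = [false] ∨ derivC^[d] w = [true]}

/-- The height h(v): the least n ≥ 1 such that v_(n) is constant, where
v_(1) = v and v_(n+1) = ₊(v_(n)). -/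
noncomputable def height (v : List Bool) : ℕ :=
  sInf {n | 0 < n ∧ IsConstant (plusV^[n - 1] v)}

/-- Helper computing δ_i from (α_{i-1}, δ_{i-1}) along the remaining exponents. -/
def ruleAux : ℕ → ℕ → List ℕ → List ℕ
  | _, _, [] => []
  | pa, pd, a :: rest =>
    let d := if 1 < a then 1 else if 1 < pa then 0 else 1 - pd
    d :: ruleAux a d rest

/-- The sequence δ₀, δ₁, …, δ_n computed by the recursive rule (δ₀ = 1). -/
def ruleSeq : List ℕ → List ℕ
  | [] => []
  | a :: rest => 1 :: ruleAux a 1 rest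

/-- δ(v) = Σ_{i=0}^n δ_i(v), where additionally δ_n(v) = 1; δ(ε) = 1. -/
def delta (v : List Bool) : ℕ := ((ruleSeq (blockLens v)).dropLast).sum + 1

/-- |u₁|: length of the longest prefix x₀⋯x_i of u with i < n and α₀ = ⋯ = α_i = 1
(and 0 if α₀ > 1 or n = 0). -/
def u1len (u : List Bool) : ℕ :=
  min ((blockLens u).takeWhile (fun n => n == 1)).length ((blockLens u).length - 1)

/-- |u₂|: the symmetric notion for suffixes. -/
def u2len (u : List Bool) : ℕ := u1len u.reverse

/-- The sequence H: H(1) = 0, H(2n) = H(n), H(4n±1) = H(n)+1. -/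
def H : ℕ → ℕ
  | 0 => 0
  | 1 => 0
  | n + 2 =>
    if (n + 2) % 2 = 0 then H ((n + 2) / 2)
    else if (n + 2) % 4 = 1 then H ((n + 2) / 4) + 1
    else H ((n + 3) / 4) + 1
decreasing_by all_goals omega

/-- ⟨w⟩: the word w read as an integer in base 2 (a = 0, b = 1). -/
def wordVal (w : List Bool) : ℕ :=
  w.foldl (fun acc x => 2 * acc + (if x then 1 else 0)) 0

/-- Membership in X^*: w is a concatenation of words of X. -/
def InStar (X : Set (List Bool)) (w : List Bool) : Prop :=
  ∃ l : List (List Bool), (∀ u ∈ l, u ∈ X) ∧ w = l.flatten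

/-- w ∈ x⁺. -/
def PowPos (x : Bool) (w : List Bool) : Prop := ∃ k, 0 < k ∧ w = List.replicate k x

/-- `q` is the longest palindromic suffix of `s ++ q`. -/
def IsLongestPalSuffix (s q : List Bool) : Prop :=
  q.reverse = q ∧ ∀ s' q', s ++ q = s' ++ q' → q'.reverse = q' → q'.length ≤ q.length

theorem exists_isLongestPalSuffix (w : List Bool) :
    ∃ s q, w = s ++ q ∧ IsLongestPalSuffix s q := by
  induction w with
  | nil => exact ⟨[], [], rfl, rfl, fun s' q' h _ => by simp_all⟩
  | cons c t ih =>
    by_cases hp : (c :: t).reverse = c :: t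
    · refine ⟨[], c :: t, rfl, hp, fun s' q' h _ => ?_⟩
      have := congrArg List.length h
      simp only [List.nil_append, List.length_append] at this
      omega
    · obtain ⟨s, q, rfl, hq, hmax⟩ := ih
      refine ⟨c :: s, q, rfl, hq, fun s' q' h hq' => ?_⟩
      cases s' with
      | nil =>
        simp only [List.nil_append, List.cons_append] at h
        rw [h] at hp
        exact absurd hq' hp
      | cons d s'' =>
        simp only [List.cons_append, List.cons.injEq] at h
        exact hmax s'' q' h.2 hq'

theorem le_foldr_max {l : List ℕ} {a : ℕ} (h : a ∈ l) : a ≤ l.foldr max 0 := by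
  induction l with
  | nil => simp at h
  | cons b l ih =>
    rcases List.mem_cons.1 h with rfl | h
    · simp
    · exact le_max_of_le_right (ih h)

theorem foldr_max_le {l : List ℕ} {n : ℕ} (h : ∀ a ∈ l, a ≤ n) : l.foldr max 0 ≤ n := by
  induction l with
  | nil => simp
  | cons b l ih =>
    exact max_le (h b (by simp)) (ih fun a ha => h a (by simp [ha]))

theorem lpsLen_eq {s q : List Bool} (h : IsLongestPalSuffix s q) :
    lpsLen (s ++ q) = q.length := by
  apply le_antisymm
  · refine foldr_max_le fun l hl => ?_
    simp only [List.mem_filter, List.mem_range, beq_iff_eq] at hl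
    have := h.2 _ _ (List.take_append_drop ((s ++ q).length - l) (s ++ q)).symm hl.2.symm
    rw [List.length_drop] at this
    omega
  · refine le_foldr_max ?_
    simp only [List.mem_filter, List.mem_range, beq_iff_eq]
    simp [h.1]

theorem palClosure_append {s q : List Bool} (h : IsLongestPalSuffix s q) :
    palClosure (s ++ q) = s ++ q ++ s.reverse := by
  simp [palClosure, lpsLen_eq h]

theorem applyM_append (f : Bool → List Bool) (u v : List Bool) :
    applyM f (u ++ v) = applyM f u ++ applyM f v := by
  simp [applyM]

theorem applyM_cons (f : Bool → List Bool) (c : Bool) (v : List Bool) :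
    applyM f (c :: v) = f c ++ applyM f v := by
  simp [applyM]

theorem applyM_nil (f : Bool → List Bool) : applyM f [] = [] := rfl

theorem muL_append (x : Bool) (u v : List Bool) : muL x (u ++ v) = muL x u ++ muL x v :=
  applyM_append _ u v

theorem muL_nil (x : Bool) : muL x [] = [] := rfl

theorem muL_cons (x c : Bool) (v : List Bool) :
    muL x (c :: v) = (if c = x then [x] else [x, c]) ++ muL x v :=
  applyM_cons _ c v

theorem reverse_muL_append (x : Bool) (w : List Bool) :
    (muL x w ++ [x]).reverse = muL x w.reverse ++ [x] := by
  induction w with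
  | nil => rfl
  | cons c t ih =>
    rw [muL_cons, List.append_assoc, List.reverse_append, ih, List.reverse_cons, muL_append,
      muL_cons, muL_nil]
    by_cases h : c = x <;> simp [h]

theorem muL_injective (x : Bool) : Function.Injective (muL x) := by
  intro u
  induction u with
  | nil =>
    intro v h
    cases v with
    | nil => rfl
    | cons d v => by_cases hd : d = x <;> simp [muL_cons, muL_nil, hd] at h
  | cons c u ih =>
    have head_ne : ∀ (p : List Bool) (d : Bool) (r : List Bool), d ≠ x → muL x p ≠ d :: r := by
      intro p d r hd h
      cases p with
      | nil => simp [muL_nil] at h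
      | cons e p => by_cases he : e = x <;> simp [muL_cons, he] at h <;> exact hd h.1.symm
    intro v h
    cases v with
    | nil => by_cases hc : c = x <;> simp [muL_cons, muL_nil, hc] at h
    | cons d v =>
      by_cases hc : c = x <;> by_cases hd : d = x <;> simp [muL_cons, hc, hd] at h
      · rw [hc, hd, ih h]
      · exact absurd h (head_ne _ _ _ hd)
      · exact absurd h.symm (head_ne _ _ _ hc)
      · rw [h.1, ih h.2]

/-- A suffix of `μ_x(w) x` that starts with `x` is itself of the form `μ_x(q) x`. -/
theorem exists_of_muL_append_eq {x : Bool} {w S Q : List Bool}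
    (h : muL x w ++ [x] = S ++ x :: Q) :
    ∃ s q, w = s ++ q ∧ S = muL x s ∧ x :: Q = muL x q ++ [x] := by
  induction w generalizing S with
  | nil =>
    cases S with
    | nil => exact ⟨[], [], rfl, rfl, by simpa [muL_nil] using h.symm⟩
    | cons d S => simp [muL_nil] at h
  | cons c t ih =>
    cases S with
    | nil => exact ⟨[], c :: t, rfl, rfl, h.symm⟩
    | cons d S =>
      by_cases hc : c = x
      · simp only [muL_cons, hc, if_true, List.cons_append, List.nil_append,
          List.cons.injEq] at h
        obtain ⟨s, q, rfl, rfl, hq⟩ := ih h.2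
        exact ⟨c :: s, q, rfl, by simp [muL_cons, hc, h.1], hq⟩
      · cases S with
        | nil => simp [muL_cons, hc] at h
        | cons e S =>
          simp only [muL_cons, hc, if_false, List.cons_append, List.nil_append,
            List.cons.injEq] at h
          obtain ⟨s, q, rfl, rfl, hq⟩ := ih h.2.2
          exact ⟨c :: s, q, rfl, by rw [← h.1, ← h.2.1]; simp [muL_cons, hc], hq⟩

/-- In `μ_x(w) x` every letter other than `x` is preceded by `x`. -/
theorem exists_append_of_muL_append_eq {x y : Bool} (hy : y ≠ x) {w S Q : List Bool}
    (h : muL x w ++ [x] = S ++ y :: Q) : ∃ S', S = S' ++ [x] := by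
  induction w generalizing S with
  | nil =>
    cases S with
    | nil => simp [muL_nil] at h; exact absurd h.1.symm hy
    | cons d S => simp [muL_nil] at h
  | cons c t ih =>
    cases S with
    | nil => by_cases hc : c = x <;> simp [muL_cons, hc] at h <;> exact absurd h.1.symm hy
    | cons d S =>
      by_cases hc : c = x
      · simp only [muL_cons, hc, if_true, List.cons_append, List.nil_append,
          List.cons.injEq] at h
        obtain ⟨S', rfl⟩ := ih h.2
        exact ⟨d :: S', rfl⟩
      · cases S with
        | nil => exact ⟨[], by simp [muL_cons, hc] at h; simp [h.1]⟩
        | cons e S =>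
          simp only [muL_cons, hc, if_false, List.cons_append, List.nil_append,
            List.cons.injEq] at h
          obtain ⟨S', rfl⟩ := ih h.2.2
          exact ⟨d :: e :: _, rfl⟩

/-- A nonempty palindrome ending with `y` starts with `y`. -/
theorem exists_cons_of_palindrome {y : Bool} {u S Q : List Bool} (h : u ++ [y] = S ++ Q)
    (hQ : Q.reverse = Q) (hne : Q ≠ []) : ∃ Q', Q = y :: Q' := by
  have h' := congrArg List.reverse h
  rw [List.reverse_append, List.reverse_append, hQ] at h'
  cases Q with
  | nil => exact absurd rfl hne
  | cons c Q =>
    simp at h'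
    exact ⟨Q, by rw [h'.1]⟩

theorem IsLongestPalSuffix.muL {s q : List Bool} (x : Bool) (h : IsLongestPalSuffix s q) :
    IsLongestPalSuffix (muL x s) (muL x q ++ [x]) := by
  refine ⟨by rw [reverse_muL_append, h.1], fun S Q hS hQ => ?_⟩
  rcases eq_or_ne Q [] with rfl | hne
  · simp
  rw [← List.append_assoc, ← muL_append] at hS
  obtain ⟨Q, rfl⟩ := exists_cons_of_palindrome hS hQ hne
  obtain ⟨s', q', hw, rfl, hq'⟩ := exists_of_muL_append_eq hS
  rw [hq', reverse_muL_append] at hQ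
  have hle := h.2 s' q' hw (muL_injective x (List.append_cancel_right hQ))
  obtain ⟨r, rfl⟩ : q' <:+ q :=
    List.suffix_of_suffix_length_le ⟨s', hw.symm⟩ ⟨s, rfl⟩ hle
  rw [hq', muL_append]
  simp

theorem palClosure_muL_append (x : Bool) (w : List Bool) :
    palClosure (muL x w ++ [x]) = muL x (palClosure w) ++ [x] := by
  obtain ⟨s, q, rfl, h⟩ := exists_isLongestPalSuffix w
  have hr := reverse_muL_append x s
  rw [List.reverse_append] at hr
  rw [palClosure_append h, muL_append, List.append_assoc, palClosure_append (h.muL x), muL_append,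
    muL_append, List.append_assoc _ (muL x s.reverse), ← hr]
  simp

theorem palClosure_muL_of_ne {x y : Bool} (hy : y ≠ x) (p : List Bool) :
    palClosure (muL x (p ++ [y])) = muL x (palClosure (p ++ [y])) ++ [x] := by
  rw [← palClosure_muL_append]
  obtain ⟨s, q, hw, h⟩ := exists_isLongestPalSuffix (p ++ [y])
  have hne : q ≠ [] := by
    rintro rfl
    have := h.2 p [y] (hw.symm) rfl
    simp at this
  obtain ⟨q, rfl⟩ := exists_cons_of_palindrome hw h.1 hne
  have hX := h.muL x
  have hmu : muL x (y :: q) = x :: y :: muL x q := by simp [muL_cons, hy]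
  rw [hmu] at hX
  have hpal : (y :: muL x q).reverse = y :: muL x q := by
    have := hX.1
    rw [List.reverse_append, List.reverse_cons (as := y :: muL x q)] at this
    exact List.append_cancel_right (List.cons.inj this).2
  have hY : IsLongestPalSuffix (muL x s ++ [x]) (y :: muL x q) := by
    refine ⟨hpal, fun S Q hS hQ => ?_⟩
    rcases eq_or_ne Q [] with rfl | hQne
    · simp
    have hend : muL x p ++ [x] ++ [y] = S ++ Q := by
      rw [← hS, List.append_assoc (muL x s), List.singleton_append, ← hmu, ← muL_append, ← hw,
        muL_append]
      simp [muL_cons, muL_nil, hy]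
    obtain ⟨Q, rfl⟩ := exists_cons_of_palindrome hend hQ hQne
    have hnu : muL x (s ++ y :: q) ++ [x] = S ++ y :: (Q ++ [x]) := by
      rw [muL_append, hmu]
      have := congrArg (· ++ [x]) hS
      simpa using this
    obtain ⟨S, rfl⟩ := exists_append_of_muL_append_eq hy hnu
    have := hX.2 S (x :: y :: Q ++ [x]) (by rw [muL_append, hmu] at hnu; simpa using hnu)
      (by rw [List.reverse_append, List.reverse_cons (as := y :: Q), hQ]; simp)
    simpa using this
  rw [hw, muL_append, hmu]
  have e₁ := palClosure_append hX
  have e₂ := palClosure_append hY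
  simp only [List.append_assoc, List.cons_append, List.nil_append, List.reverse_append,
    List.reverse_cons, List.reverse_nil] at e₁ e₂ ⊢
  rw [e₁, e₂]

theorem psi_append_singleton (v : List Bool) (y : Bool) :
    psi (v ++ [y]) = palClosure (psi v ++ [y]) := by
  simp [psi]

theorem palClosure_singleton (x : Bool) : palClosure [x] = [x] := by
  cases x <;> decide

/-- Justin's formula for a single letter. -/
theorem psi_cons (x : Bool) (u : List Bool) : psi (x :: u) = muL x (psi u) ++ [x] := by
  induction u using List.reverseRecOn with
  | nil => exact palClosure_singleton x
  | append_singleton u y ih =>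
    rw [← List.cons_append, psi_append_singleton, psi_append_singleton, ih]
    by_cases hy : y = x
    · subst hy
      rw [← palClosure_muL_append, muL_append]
      simp [muL_cons, muL_nil]
    · rw [← palClosure_muL_of_ne hy, muL_append]
      simp [muL_cons, muL_nil, hy]

theorem exists_psi_cons_eq_cons (x : Bool) (u : List Bool) : ∃ t, psi (x :: u) = x :: t := by
  rw [psi_cons]
  cases psi u with
  | nil => exact ⟨[], rfl⟩
  | cons c t => by_cases hc : c = x <;> simp [muL_cons, hc]

/-- The Christoffel word `a ψ(v) b`. -/
def christoffel (v : List Bool) : List Bool := false :: (psi v ++ [true])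

theorem muL_true_append (p : List Bool) : muL true p ++ [true] = true :: lamL true p := by
  induction p with
  | nil => rfl
  | cons c t ih =>
    rw [muL_cons, List.append_assoc, ih, lamL, applyM_cons]
    cases c <;> simp

theorem christoffel_cons (x : Bool) (u : List Bool) :
    christoffel (x :: u) = lamL x (christoffel u) := by
  cases x
  · have hmu : muL false (psi u) = lamL false (psi u) := by
      simp only [muL, lamL]
      congr 1
      funext y
      cases y <;> rfl
    simp [christoffel, psi_cons, hmu, lamL, applyM_cons, applyM_append, applyM_nil]
  · simp [christoffel, psi_cons, muL_true_append, lamL, applyM_cons, applyM_append, applyM_nil]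

theorem lamL_false_phi (k : ℕ) (w : List Bool) : lamL false (phi k w) = phi (k + 1) w := by
  have hrep : ∀ n, lamL false (List.replicate n false) = List.replicate n false := by
    intro n
    induction n with
    | zero => rfl
    | succ n ih => simpa [lamL, applyM_cons, List.replicate_succ] using ih
  simp only [lamL] at hrep
  induction w with
  | nil => rfl
  | cons c t ih =>
    simp only [phi, lamL] at ih
    simp only [phi, lamL, applyM_cons, applyM_append, ih]
    cases c <;>
      simp [applyM_append, applyM_cons, applyM_nil, hrep, List.replicate_succ']

theorem lamL_true_phiHat (k : ℕ) (w : List Bool) :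
    lamL true (phiHat k w) = phiHat (k + 1) w := by
  have hrep : ∀ n, lamL true (List.replicate n true) = List.replicate n true := by
    intro n
    induction n with
    | zero => rfl
    | succ n ih => simpa [lamL, applyM_cons, List.replicate_succ] using ih
  simp only [lamL] at hrep
  induction w with
  | nil => rfl
  | cons c t ih =>
    simp only [phiHat, lamL] at ih
    simp only [phiHat, lamL, applyM_cons, applyM_append, ih]
    cases c <;>
      simp [applyM_cons, hrep, List.replicate_succ]

theorem lamL_true_eq_phi (w : List Bool) : lamL true w = phi 0 w := by
  simp only [lamL, phi]
  congr 1
  funext y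
  cases y <;> rfl

theorem lamL_false_eq_phiHat (w : List Bool) : lamL false w = phiHat 0 w := by
  simp only [lamL, phiHat]
  congr 1

theorem blockLen_cons_cons_self (x : Bool) (u : List Bool) :
    blockLen (x :: x :: u) = blockLen (x :: u) + 1 := by
  simp [blockLen]

theorem exists_phi_eq_christoffel (u : List Bool) :
    ∃ z, phi (blockLen (false :: u)) z = christoffel (false :: u) := by
  induction u with
  | nil => exact ⟨[false], by decide⟩
  | cons c u ih =>
    cases c with
    | false =>
      obtain ⟨z, hz⟩ := ih
      exact ⟨z, by rw [blockLen_cons_cons_self, christoffel_cons, ← hz, lamL_false_phi]⟩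
    | true =>
      refine ⟨christoffel u, ?_⟩
      rw [christoffel_cons, christoffel_cons, lamL_true_eq_phi, lamL_false_phi]
      simp [blockLen]

theorem exists_phiHat_eq_christoffel (u : List Bool) :
    ∃ z, phiHat (blockLen (true :: u)) z = christoffel (true :: u) := by
  induction u with
  | nil => exact ⟨[true], by decide⟩
  | cons c u ih =>
    cases c with
    | true =>
      obtain ⟨z, hz⟩ := ih
      exact ⟨z, by rw [blockLen_cons_cons_self, christoffel_cons, ← hz, lamL_true_phiHat]⟩
    | false =>
      refine ⟨christoffel u, ?_⟩
      rw [christoffel_cons, christoffel_cons, lamL_false_eq_phiHat, lamL_true_phiHat]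
      simp [blockLen]

theorem count_true_phi (k : ℕ) (z : List Bool) : (phi k z).count true = z.length := by
  induction z with
  | nil => rfl
  | cons c t ih =>
    rw [phi] at ih
    rw [phi, applyM_cons, List.count_append, ih]
    cases c <;> simp [List.count_replicate, add_comm]

theorem count_false_phiHat (k : ℕ) (z : List Bool) :
    (phiHat k z).count false = z.length := by
  induction z with
  | nil => rfl
  | cons c t ih =>
    rw [phiHat] at ih
    rw [phiHat, applyM_cons, List.count_append, ih]
    cases c <;> simp [List.count_replicate, add_comm]

/-- The derivative of `a ψ(xu) b` has as many letters as `a ψ(xu) b` has occurrences of the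
complement of `x`. -/
theorem length_derivC_christoffel_cons (x : Bool) (u : List Bool) :
    (derivC (christoffel (x :: u))).length = (christoffel (x :: u)).count !x := by
  have hex : ∃ v, v ≠ [] ∧ christoffel (x :: u) = false :: (psi v ++ [true]) :=
    ⟨x :: u, by simp, rfl⟩
  obtain ⟨t, ht⟩ := exists_psi_cons_eq_cons x u
  have hne : christoffel (x :: u) ≠ [false, true] := by
    rw [christoffel, ht]
    simp
  rw [derivC, if_neg hne, dif_pos hex]
  generalize hv : hex.choose = v'
  have hspec := hex.choose_spec
  rw [hv] at hspec
  obtain ⟨hv', hw⟩ := hspec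
  cases v' with
  | nil => exact absurd rfl hv'
  | cons c u' =>
    obtain ⟨t', ht'⟩ := exists_psi_cons_eq_cons c u'
    have hc : x = c := by
      rw [christoffel, ht, ht'] at hw
      simp at hw
      exact hw.1
    subst hc
    change christoffel (x :: u) = christoffel (x :: u') at hw
    rw [hw]
    cases x with
    | false =>
      have := Function.invFun_eq (exists_phi_eq_christoffel u')
      rw [List.headD_cons, if_pos rfl, ← count_true_phi (blockLen (false :: u')), this]
      rfl
    | true =>
      have := Function.invFun_eq (exists_phiHat_eq_christoffel u')
      rw [List.headD_cons, if_neg (by simp), ← count_false_phiHat (blockLen (true :: u')), this]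
      rfl

theorem length_muL (x : Bool) (p : List Bool) :
    (muL x p).length = p.length + (muL x p).count !x := by
  induction p with
  | nil => rfl
  | cons c t ih =>
    rw [muL_cons, List.length_append, List.count_append, ih]
    cases c <;> cases x <;> simp <;> omega

theorem length_psi_cons (x : Bool) (u : List Bool) :
    (psi (x :: u)).length = (derivC (christoffel (x :: u))).length + (psi u).length := by
  rw [length_derivC_christoffel_cons, christoffel, psi_cons, List.length_append, length_muL]
  cases x <;> simp <;> omega

/-- |ψ(v)| is the sum over all suffixes v_i⋯v_n of v of the lengths
of the derivatives of the corresponding Christoffel words. -/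
theorem psi_length_eq_sum_deriv_lengths (v : List Bool) :
    (psi v).length =
      ∑ i ∈ Finset.range v.length,
        (derivC (false :: (psi (v.drop i) ++ [true]))).length := by
  induction v with
  | nil => rfl
  | cons x u ih =>
    rw [length_psi_cons, ih, List.length_cons, Finset.sum_range_succ', add_comm]
    rfl

end Chri
end

section
/- Let u and v be nonempty words over A = {a,b}. Then δ(u) + δ(v) − 1 ≤ δ(uv) ≤ δ(u) + δ(v). Moreover, δ(uv) = δ(u) + δ(v) if and only if the last letter of u differs from the first letter of v and both |u₂| and |v₁| are even. -/
namespace Chri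

attribute [local instance] Classical.propDecidable

/-- The recursive rule for `δ_i`, in terms of `δ_{i-1} = p` and the exponent `a = α_i` alone. -/
def deltaStep (p a : ℕ) : ℕ := if 1 < a then 1 else 1 - p

/-- The sum of the states visited by iterating `deltaStep` from `p` along a list of exponents,
including the initial state and excluding the final one. -/
def stateSum : ℕ → List ℕ → ℕ
  | _, [] => 0
  | p, a :: l => p + stateSum (deltaStep p a) l

/-- The length of the longest proper prefix of `l` all of whose entries are `1`. -/
def onesLen (l : List ℕ) : ℕ := min (l.takeWhile (fun n => n == 1)).length (l.length - 1)

theorem deltaStep_of_one_lt {p a : ℕ} (h : 1 < a) : deltaStep p a = 1 := if_pos h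

theorem deltaStep_one (p : ℕ) : deltaStep p 1 = 1 - p := if_neg (lt_irrefl 1)

theorem deltaStep_zero (a : ℕ) : deltaStep 0 a = 1 := by
  unfold deltaStep; split <;> rfl

theorem stateSum_append (p : ℕ) (l r : List ℕ) :
    stateSum p (l ++ r) = stateSum p l + stateSum (l.foldl deltaStep p) r := by
  induction l generalizing p with
  | nil => simp [stateSum]
  | cons a l ih => simp [stateSum, ih, add_assoc]

theorem sum_dropLast_ruleAux (pa pd : ℕ) (h : 1 < pa → pd = 1) (l : List ℕ) :
    ((pd :: ruleAux pa pd l).dropLast).sum = stateSum pd l := by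
  induction l generalizing pa pd with
  | nil => simp [ruleAux, stateSum]
  | cons a l ih =>
    have hd : (if 1 < a then 1 else if 1 < pa then 0 else 1 - pd) = deltaStep pd a := by
      unfold deltaStep
      split_ifs with h₁ h₂
      · rfl
      · simp [h h₂]
      · rfl
    have := ih a (deltaStep pd a) deltaStep_of_one_lt
    simp only [ruleAux, stateSum, hd]
    rw [List.dropLast_cons_of_ne_nil (by simp), List.sum_cons, this]

theorem delta_eq_stateSum (v : List Bool) : delta v = stateSum 0 (blockLens v) + 1 := by
  unfold delta
  cases blockLens v with
  | nil => rfl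
  | cons a l =>
    simp only [ruleSeq, stateSum, deltaStep_zero, zero_add]
    rw [sum_dropLast_ruleAux a 1 (fun _ => rfl)]

theorem onesLen_singleton (a : ℕ) : onesLen [a] = 0 := by simp [onesLen]

theorem onesLen_one_cons {l : List ℕ} (hl : l ≠ []) : onesLen (1 :: l) = onesLen l + 1 := by
  have := List.length_pos_of_ne_nil hl
  simp only [onesLen, beq_self_eq_true, List.takeWhile_cons_of_pos, List.length_cons]
  omega

theorem onesLen_cons_of_one_lt {a : ℕ} (h : 1 < a) (l : List ℕ) : onesLen (a :: l) = 0 := by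
  have : (a == 1) = false := by simpa using h.ne'
  simp [onesLen, this]

theorem stateSum_one {l : List ℕ} (hl : l ≠ []) (hpos : ∀ a ∈ l, 0 < a) :
    stateSum 1 l = stateSum 0 l + if Even (onesLen l) then 1 else 0 := by
  induction l with
  | nil => exact absurd rfl hl
  | cons a l ih =>
    rcases eq_or_ne l [] with rfl | hne
    · simp [stateSum, onesLen_singleton]
    · obtain rfl | ha : a = 1 ∨ 1 < a := by have := hpos a (by simp); omega
      · have := ih hne fun b hb => hpos b (by simp [hb])
        simp only [stateSum, deltaStep_one, onesLen_one_cons hne, Nat.even_add_one, Nat.sub_self,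
          Nat.sub_zero, this]
        split_ifs <;> omega
      · simp [stateSum, deltaStep_of_one_lt ha, onesLen_cons_of_one_lt ha, add_comm]

theorem foldl_deltaStep {l : List ℕ} (hl : l ≠ []) (hpos : ∀ a ∈ l, 0 < a) :
    l.foldl deltaStep 0 = if Even (onesLen l.reverse) then 1 else 0 := by
  induction l using List.reverseRecOn with
  | nil => exact absurd rfl hl
  | append_singleton l a ih =>
    rcases eq_or_ne l [] with rfl | hne
    · simp [deltaStep_zero, onesLen_singleton]
    · obtain rfl | ha : a = 1 ∨ 1 < a := by have := hpos a (by simp); omega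
      · have := ih hne fun b hb => hpos b (by simp [hb])
        simp only [List.foldl_append, List.foldl_cons, List.foldl_nil, deltaStep_one, this,
          List.reverse_append, List.reverse_singleton, List.singleton_append,
          onesLen_one_cons (List.reverse_ne_nil_iff.2 hne), Nat.even_add_one]
        split_ifs <;> rfl
      · simp [deltaStep_of_one_lt ha, onesLen_cons_of_one_lt ha]

theorem blockLens_cons_ne_nil (x : Bool) (v : List Bool) : blockLens (x :: v) ≠ [] := by
  cases v with
  | nil => simp [blockLens]
  | cons y v => simp only [blockLens]; split <;> [split; skip] <;> simp

theorem blockLens_ne_nil {v : List Bool} (hv : v ≠ []) : blockLens v ≠ [] := by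
  obtain ⟨x, v, rfl⟩ := List.exists_cons_of_ne_nil hv
  exact blockLens_cons_ne_nil x v

theorem blockLens_cons_cons_of_ne {x y : Bool} (h : x ≠ y) (v : List Bool) :
    blockLens (x :: y :: v) = 1 :: blockLens (y :: v) := by
  simp only [blockLens, if_neg h]

theorem blockLens_cons_cons_self {x : Bool} {v : List Bool} {n : ℕ} {l : List ℕ}
    (h : blockLens (x :: v) = n :: l) : blockLens (x :: x :: v) = (n + 1) :: l := by
  simp only [blockLens, if_true, h]

theorem blockLens_pos (v : List Bool) : ∀ a ∈ blockLens v, 0 < a := by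
  induction v with
  | nil => simp [blockLens]
  | cons x v ih =>
    cases v with
    | nil => simp [blockLens]
    | cons y v =>
      by_cases hxy : x = y
      · subst hxy
        obtain ⟨n, l, h⟩ := List.exists_cons_of_ne_nil (blockLens_cons_ne_nil x v)
        rw [blockLens_cons_cons_self h]
        rw [h] at ih
        simp_all
      · rw [blockLens_cons_cons_of_ne hxy]
        simpa using ih

theorem blockLens_append_of_ne {u v : List Bool} (hu : u ≠ []) (hv : v ≠ [])
    (h : u.getLast hu ≠ v.head hv) : blockLens (u ++ v) = blockLens u ++ blockLens v := by
  induction u with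
  | nil => exact absurd rfl hu
  | cons x u ih =>
    cases u with
    | nil =>
      obtain ⟨y, v, rfl⟩ := List.exists_cons_of_ne_nil hv
      exact blockLens_cons_cons_of_ne (by simpa using h) v
    | cons y u =>
      have ih := ih (by simp) (by simpa using h)
      by_cases hxy : x = y
      · subst hxy
        obtain ⟨n, l, hl⟩ := List.exists_cons_of_ne_nil (blockLens_cons_ne_nil x u)
        rw [blockLens_cons_cons_self hl]
        rw [hl] at ih
        exact blockLens_cons_cons_self ih
      · rw [blockLens_cons_cons_of_ne hxy]
        simp only [List.cons_append] at ih ⊢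
        rw [blockLens_cons_cons_of_ne hxy, ih]

theorem exists_blockLens_append_of_eq {u v : List Bool} (hu : u ≠ []) (hv : v ≠ [])
    (h : u.getLast hu = v.head hv) :
    ∃ l m k r, blockLens u = l ++ [m] ∧ blockLens v = k :: r ∧
      blockLens (u ++ v) = l ++ (m + k) :: r := by
  induction u with
  | nil => exact absurd rfl hu
  | cons x u ih =>
    cases u with
    | nil =>
      obtain ⟨y, v, rfl⟩ := List.exists_cons_of_ne_nil hv
      obtain rfl : x = y := by simpa using h
      obtain ⟨k, r, hk⟩ := List.exists_cons_of_ne_nil (blockLens_cons_ne_nil x v)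
      exact ⟨[], 1, k, r, rfl, hk, by simpa [add_comm] using blockLens_cons_cons_self hk⟩
    | cons y u =>
      obtain ⟨l, m, k, r, h₁, h₂, h₃⟩ := ih (by simp) (by simpa using h)
      by_cases hxy : x = y
      · subst hxy
        cases l with
        | nil =>
          refine ⟨[], m + 1, k, r, blockLens_cons_cons_self h₁, h₂, ?_⟩
          rw [add_right_comm]
          exact blockLens_cons_cons_self h₃
        | cons n l =>
          exact ⟨(n + 1) :: l, m, k, r, blockLens_cons_cons_self h₁, h₂,
            blockLens_cons_cons_self h₃⟩
      · refine ⟨1 :: l, m, k, r, ?_, h₂, ?_⟩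
        · rw [blockLens_cons_cons_of_ne hxy, h₁, List.cons_append]
        · simp only [List.cons_append] at h₃ ⊢
          rw [blockLens_cons_cons_of_ne hxy, h₃]

theorem blockLens_reverse (v : List Bool) : blockLens v.reverse = (blockLens v).reverse := by
  induction v with
  | nil => rfl
  | cons x v ih =>
    cases v with
    | nil => rfl
    | cons y v =>
      rw [List.reverse_cons]
      have hne : (y :: v).reverse ≠ [] := by simp
      by_cases hxy : x = y
      · subst hxy
        obtain ⟨l, m, k, r, h₁, h₂, h₃⟩ :=
          exists_blockLens_append_of_eq hne (List.cons_ne_nil x []) (by simp)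
        obtain ⟨rfl, rfl⟩ : 1 = k ∧ [] = r := by simpa [blockLens] using h₂
        rw [ih, List.reverse_eq_iff] at h₁
        rw [h₃, blockLens_cons_cons_self (by simpa using h₁)]
        simp
      · rw [blockLens_append_of_ne hne (List.cons_ne_nil x []) (by simpa using Ne.symm hxy), ih,
          blockLens_cons_cons_of_ne hxy]
        simp [blockLens]

theorem delta_append_of_eq {u v : List Bool} (hu : u ≠ []) (hv : v ≠ [])
    (h : u.getLast hu = v.head hv) : delta (u ++ v) + 1 = delta u + delta v := by
  obtain ⟨l, m, k, r, h₁, h₂, h₃⟩ := exists_blockLens_append_of_eq hu hv h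
  have hm : 0 < m := blockLens_pos u m (by simp [h₁])
  have hk : 0 < k := blockLens_pos v k (by simp [h₂])
  simp only [delta_eq_stateSum, h₁, h₂, h₃, stateSum_append, stateSum, deltaStep_zero,
    deltaStep_of_one_lt (show 1 < m + k by omega)]
  omega

theorem delta_append_of_ne {u v : List Bool} (hu : u ≠ []) (hv : v ≠ [])
    (h : u.getLast hu ≠ v.head hv) :
    delta (u ++ v) + 1 =
      delta u + delta v + if Even (u2len u) ∧ Even (u1len v) then 1 else 0 := by
  have hu₂ : u2len u = onesLen (blockLens u).reverse := by
    rw [← blockLens_reverse]; rfl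
  have hv₁ : u1len v = onesLen (blockLens v) := rfl
  simp only [delta_eq_stateSum, blockLens_append_of_ne hu hv h, stateSum_append,
    foldl_deltaStep (blockLens_ne_nil hu) (blockLens_pos u), ← hu₂]
  by_cases hE : Even (u2len u)
  · simp only [hE, if_true, true_and, stateSum_one (blockLens_ne_nil hv) (blockLens_pos v), ← hv₁]
    omega
  · simp only [hE, if_false, false_and]
    omega

/-- δ(u) + δ(v) − 1 ≤ δ(uv) ≤ δ(u) + δ(v), with equality on the
right iff the last letter of u differs from the first letter of v and |u₂|, |v₁|
are both even. -/
theorem delta_append (u v : List Bool) (hu : u ≠ []) (hv : v ≠ []) :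
    (delta u + delta v - 1 ≤ delta (u ++ v) ∧ delta (u ++ v) ≤ delta u + delta v) ∧
    (delta (u ++ v) = delta u + delta v ↔
      u.getLast hu ≠ v.head hv ∧ Even (u2len u) ∧ Even (u1len v)) := by
  by_cases h : u.getLast hu = v.head hv
  · have := delta_append_of_eq hu hv h
    simp only [h, ne_eq, not_true_eq_false, false_and, iff_false]
    omega
  · have := delta_append_of_ne hu hv h
    simp only [h, ne_eq, not_false_eq_true, true_and]
    split_ifs at this with hE
    · exact ⟨by omega, iff_of_true (by omega) hE⟩
    · exact ⟨by omega, iff_of_false (by omega) hE⟩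

end Chri
end

section
/- For every word v over A = {a,b}, ⌊ext(v)/2⌋ + 1 ≤ h(v) ≤ ⌊|v|/2⌋ + 1. Moreover: (i) the upper bound is attained, i.e. h(v) = ⌊|v|/2⌋ + 1, if and only if v ∈ {ab,ba}^*·{ε,a,b}·{ab,ba}^*; (ii) the lower bound is attained, i.e. h(v) = ⌊ext(v)/2⌋ + 1, if and only if, for some choice of letters {x,y} = {a,b}, either ext(v) is odd and v ∈ x⁺(y x⁺)^*, or ext(v) is even and v ∈ {ε} ∪ x⁺(y x⁺)^*(y⁺ x)^* y⁺. -/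
namespace Chri

attribute [local instance] Classical.propDecidable

/-! ### Letter-by-letter recursion for words, heights and extents -/

theorem word_induction {P : List Bool → Prop} (nil : P []) (single : ∀ x, P [x])
    (same : ∀ x w, P (x :: w) → P (x :: x :: w))
    (diff : ∀ x w, P w → P (x :: (!x) :: w)) (v : List Bool) : P v := by
  induction hn : v.length using Nat.strong_induction_on generalizing v with
  | _ n ih =>
    match v with
    | [] => exact nil
    | [x] => exact single x
    | x :: y :: w =>
      subst hn
      by_cases h : y = x
      · subst h
        exact same _ _ (ih _ (by simp) _ rfl)
      · obtain rfl : y = !x := Bool.eq_not_of_ne h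
        exact diff _ _ (ih _ (by simp) _ rfl)

theorem isConstant_nil : IsConstant [] := ⟨false, 0, rfl⟩

theorem isConstant_singleton (x : Bool) : IsConstant [x] := ⟨x, 1, rfl⟩

theorem isConstant_cons_iff (x : Bool) (w : List Bool) :
    IsConstant (x :: w) ↔ ∀ y ∈ w, y = x := by
  constructor
  · rintro ⟨y, n, h⟩ z hz
    have hx : x = y := List.eq_of_mem_replicate (h ▸ List.mem_cons_self)
    exact (List.eq_of_mem_replicate (h ▸ List.mem_cons_of_mem x hz)).trans hx.symm
  · intro h
    exact ⟨x, w.length + 1, List.eq_replicate_iff.2 ⟨rfl, by simpa using h⟩⟩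

theorem plusV_cons_same (x : Bool) (w : List Bool) :
    plusV (x :: x :: w) = plusV (x :: w) := by
  simp [plusV]

theorem plusV_cons_not (x : Bool) (w : List Bool) : plusV (x :: (!x) :: w) = w := by
  cases x <;> simp [plusV]

theorem exists_isConstant_iterate (v : List Bool) : ∃ n, IsConstant (plusV^[n] v) := by
  induction v using word_induction with
  | nil => exact ⟨0, isConstant_nil⟩
  | single x => exact ⟨0, isConstant_singleton x⟩
  | same x w ih =>
    obtain ⟨n, hn⟩ := ih
    cases n with
    | zero =>
      refine ⟨0, ?_⟩
      simpa [isConstant_cons_iff] using hn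
    | succ n =>
      refine ⟨n + 1, ?_⟩
      rwa [Function.iterate_succ_apply, plusV_cons_same, ← Function.iterate_succ_apply]
  | diff x w ih =>
    obtain ⟨n, hn⟩ := ih
    exact ⟨n + 1, by rwa [Function.iterate_succ_apply, plusV_cons_not]⟩

theorem height_spec (v : List Bool) :
    0 < height v ∧ IsConstant (plusV^[height v - 1] v) := by
  obtain ⟨n, hn⟩ := exists_isConstant_iterate v
  exact Nat.sInf_mem (s := {n | 0 < n ∧ IsConstant (plusV^[n - 1] v)})
    ⟨n + 1, by simp, by simpa using hn⟩

theorem height_le {v : List Bool} {n : ℕ} (h : IsConstant (plusV^[n] v)) :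
    height v ≤ n + 1 :=
  Nat.sInf_le ⟨by simp, by simpa using h⟩

theorem height_of_isConstant {v : List Bool} (h : IsConstant v) : height v = 1 :=
  le_antisymm (height_le (n := 0) h) (height_spec v).1

theorem height_of_not_isConstant {v : List Bool} (h : ¬ IsConstant v) :
    height v = height (plusV v) + 1 := by
  obtain ⟨hpos, hc⟩ := height_spec v
  obtain ⟨hpos', hc'⟩ := height_spec (plusV v)
  apply le_antisymm
  · refine height_le ?_
    obtain ⟨m, hm⟩ : ∃ m, height (plusV v) = m + 1 := ⟨_, (Nat.sub_add_cancel hpos').symm⟩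
    rw [hm] at hc' ⊢
    simpa [Function.iterate_succ_apply] using hc'
  · obtain ⟨m, hm⟩ : ∃ m, height v = m + 1 := ⟨_, (Nat.sub_add_cancel hpos).symm⟩
    rw [hm] at hc ⊢
    cases m with
    | zero => exact absurd hc h
    | succ m =>
      have := height_le (v := plusV v) (n := m)
        (by simpa [Function.iterate_succ_apply] using hc)
      omega

theorem height_nil : height [] = 1 := height_of_isConstant isConstant_nil

theorem height_singleton (x : Bool) : height [x] = 1 :=
  height_of_isConstant (isConstant_singleton x)

theorem height_cons_same (x : Bool) (w : List Bool) :
    height (x :: x :: w) = height (x :: w) := by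
  have hiff : IsConstant (x :: x :: w) ↔ IsConstant (x :: w) := by
    simp [isConstant_cons_iff]
  by_cases h : IsConstant (x :: w)
  · rw [height_of_isConstant h, height_of_isConstant (hiff.2 h)]
  · rw [height_of_not_isConstant h, height_of_not_isConstant (mt hiff.1 h), plusV_cons_same]

theorem height_cons_not (x : Bool) (w : List Bool) :
    height (x :: (!x) :: w) = height w + 1 := by
  rw [height_of_not_isConstant, plusV_cons_not]
  simp [isConstant_cons_iff]

theorem ext_nil : ext [] = 0 := rfl

theorem ext_singleton (x : Bool) : ext [x] = 1 := rfl

theorem ext_cons_not (x : Bool) (w : List Bool) :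
    ext (x :: (!x) :: w) = ext ((!x) :: w) + 1 := by
  simp [ext, blockLens]

theorem ext_cons_pos (x : Bool) (w : List Bool) : 0 < ext (x :: w) := by
  cases w with
  | nil => simp [ext, blockLens]
  | cons y w =>
    simp only [ext, blockLens]
    split_ifs
    · split <;> simp
    · simp

theorem ext_cons_same (x : Bool) (w : List Bool) : ext (x :: x :: w) = ext (x :: w) := by
  have h := ext_cons_pos x w
  simp only [ext, blockLens, if_true] at h ⊢
  split
  · simp_all
  · simp_all

theorem ext_cons_not_cons (x : Bool) (w : List Bool) :
    ext (x :: (!x) :: x :: w) = ext (x :: w) + 2 := by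
  have := ext_cons_not (!x) w
  rw [Bool.not_not] at this
  rw [ext_cons_not, this]

theorem ext_cons_not_not_cons (x : Bool) (w : List Bool) :
    ext (x :: (!x) :: (!x) :: w) = ext ((!x) :: w) + 1 := by
  rw [ext_cons_not, ext_cons_same]

/-! ### Words of maximal height -/

/-- Membership in `{ab,ba}^*`. -/
def IsPairProduct : List Bool → Prop
  | [] => True
  | [_] => False
  | x :: y :: w => y = (!x) ∧ IsPairProduct w

/-- Membership in `{ab,ba}^*·{ε,a,b}·{ab,ba}^*`. -/
def IsHeightMax : List Bool → Prop
  | [] => True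
  | [_] => True
  | x :: y :: w => (y = x ∧ IsPairProduct (y :: w)) ∨ (y = (!x) ∧ IsHeightMax w)

theorem IsPairProduct.even_length {v : List Bool} (h : IsPairProduct v) : Even v.length := by
  induction v using word_induction with
  | nil => simp
  | single x => simp [IsPairProduct] at h
  | same x w ih => simp [IsPairProduct] at h
  | diff x w ih =>
    have := ih (by simpa [IsPairProduct] using h)
    simpa [Nat.even_add_one] using this

theorem IsPairProduct.isHeightMax {v : List Bool} (h : IsPairProduct v) : IsHeightMax v := by
  induction v using word_induction with
  | nil => simp [IsHeightMax]
  | single x => simp [IsHeightMax]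
  | same x w ih => simp [IsPairProduct] at h
  | diff x w ih => simpa [IsHeightMax] using ih (by simpa [IsPairProduct] using h)

theorem IsHeightMax.isPairProduct {v : List Bool} (h : IsHeightMax v) (hv : Even v.length) :
    IsPairProduct v := by
  induction v using word_induction with
  | nil => simp [IsPairProduct]
  | single x => simp at hv
  | same x w ih =>
    have h' : IsPairProduct (x :: w) := by simpa [IsHeightMax] using h
    have := h'.even_length
    simp only [List.length_cons, Nat.even_add_one] at this hv
    tauto
  | diff x w ih =>
    simpa [IsPairProduct] using
      ih (by simpa [IsHeightMax] using h) (by simpa [Nat.even_add_one] using hv)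

theorem height_le_length (v : List Bool) : height v ≤ v.length / 2 + 1 := by
  induction v using word_induction with
  | nil => simp [height_nil]
  | single x => simp [height_singleton]
  | same x w ih =>
    rw [height_cons_same]
    simp only [List.length_cons] at ih ⊢
    omega
  | diff x w ih =>
    rw [height_cons_not]
    simp only [List.length_cons]
    omega

theorem height_eq_length_iff_isHeightMax (v : List Bool) :
    height v = v.length / 2 + 1 ↔ IsHeightMax v := by
  induction v using word_induction with
  | nil => simp [height_nil, IsHeightMax]
  | single x => simp [height_singleton, IsHeightMax]
  | same x w ih =>
    have hle := height_le_length (x :: w)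
    have hmax : IsHeightMax (x :: x :: w) ↔ IsPairProduct (x :: w) := by simp [IsHeightMax]
    rw [height_cons_same, hmax]
    constructor
    · intro h
      have hev : (x :: w).length % 2 = 0 := by
        simp only [List.length_cons] at h hle ⊢
        omega
      refine IsHeightMax.isPairProduct (ih.1 ?_) (Nat.even_iff.2 hev)
      simp only [List.length_cons] at h hle hev ⊢
      omega
    · intro h
      have hev := Nat.even_iff.1 h.even_length
      have := ih.2 h.isHeightMax
      simp only [List.length_cons] at this hev ⊢
      omega
  | diff x w ih =>
    have hmax : IsHeightMax (x :: (!x) :: w) ↔ IsHeightMax w := by simp [IsHeightMax]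
    rw [height_cons_not, hmax, ← ih]
    simp only [List.length_cons]
    omega

theorem inStar_nil (X : Set (List Bool)) : InStar X [] := ⟨[], by simp, rfl⟩

theorem InStar.append_left {X : Set (List Bool)} {u w : List Bool} (hu : u ∈ X)
    (hw : InStar X w) : InStar X (u ++ w) := by
  obtain ⟨l, hl, rfl⟩ := hw
  exact ⟨u :: l, by simpa using ⟨hu, hl⟩, by simp⟩

theorem pair_mem (x : Bool) :
    [x, !x] ∈ ({[false, true], [true, false]} : Set (List Bool)) := by
  cases x <;> simp

theorem InStar.pair_induction {P : List Bool → Prop} (nil : P [])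
    (cons : ∀ x w, P w → P (x :: (!x) :: w)) {v : List Bool}
    (h : InStar ({[false, true], [true, false]} : Set (List Bool)) v) : P v := by
  obtain ⟨l, hl, rfl⟩ := h
  induction l with
  | nil => exact nil
  | cons u l ih =>
    have ih' := ih fun u hu => hl u (List.mem_cons_of_mem _ hu)
    rcases hl u List.mem_cons_self with rfl | rfl
    · exact cons false _ ih'
    · exact cons true _ ih'

theorem inStar_pair_iff (v : List Bool) :
    InStar ({[false, true], [true, false]} : Set (List Bool)) v ↔ IsPairProduct v := by
  constructor
  · exact InStar.pair_induction (by simp [IsPairProduct])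
      fun x w hw => by simpa [IsPairProduct] using hw
  · intro h
    induction v using word_induction with
    | nil => exact inStar_nil _
    | single x => simp [IsPairProduct] at h
    | same x w ih => simp [IsPairProduct] at h
    | diff x w ih =>
      exact InStar.append_left (pair_mem x) (ih (by simpa [IsPairProduct] using h))

theorem IsPairProduct.isHeightMax_cons {w : List Bool} (h : IsPairProduct w) (x : Bool) :
    IsHeightMax (x :: w) := by
  induction w using word_induction with
  | nil => simp [IsHeightMax]
  | single y => simp [IsPairProduct] at h
  | same y w ih => simp [IsPairProduct] at h
  | diff y w ih =>
    by_cases hxy : y = x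
    · subst hxy
      exact Or.inl ⟨rfl, h⟩
    · obtain rfl : y = !x := Bool.eq_not_of_ne hxy
      refine Or.inr ⟨rfl, ?_⟩
      simpa using ih (by simpa [IsPairProduct] using h)

theorem exists_factorization_iff_isHeightMax (v : List Bool) :
    (∃ p q r, InStar ({[false, true], [true, false]} : Set (List Bool)) p ∧
        InStar ({[false, true], [true, false]} : Set (List Bool)) r ∧
        (q = [] ∨ q = [false] ∨ q = [true]) ∧ v = p ++ q ++ r) ↔ IsHeightMax v := by
  constructor
  · rintro ⟨p, q, r, hp, hr, hq, rfl⟩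
    rw [inStar_pair_iff] at hr
    refine InStar.pair_induction (P := fun p => IsHeightMax (p ++ q ++ r)) ?_
      (fun x w hw => Or.inr ⟨rfl, hw⟩) hp
    rcases hq with rfl | rfl | rfl
    · exact hr.isHeightMax
    · exact hr.isHeightMax_cons _
    · exact hr.isHeightMax_cons _
  · intro h
    induction v using word_induction with
    | nil => exact ⟨[], [], [], inStar_nil _, inStar_nil _, by simp, rfl⟩
    | single x => exact ⟨[], [x], [], inStar_nil _, inStar_nil _, by cases x <;> simp, rfl⟩
    | same x w ih =>
      have h' : IsPairProduct (x :: w) := by simpa [IsHeightMax] using h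
      exact ⟨[], [x], x :: w, inStar_nil _, (inStar_pair_iff _).2 h', by cases x <;> simp, rfl⟩
    | diff x w ih =>
      obtain ⟨p, q, r, hp, hr, hq, rfl⟩ := ih (by simpa [IsHeightMax] using h)
      exact ⟨[x, !x] ++ p, q, r, hp.append_left (pair_mem x), hr, hq, by simp⟩

/-! ### Words of minimal height -/

/-- Membership in `x⁺(y x⁺)^*`, where `y` is the complement of `x`. -/
def IsOddMin (x : Bool) : List Bool → Prop
  | [] => False
  | [z] => z = x
  | z :: t :: w => z = x ∧ ((t = x ∧ IsOddMin x (t :: w)) ∨ (t = (!x) ∧ IsOddMin x w))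

/-- Membership in `x⁺(y x⁺)^*(y⁺ x)^* y⁺`, where `y` is the complement of `x`. -/
def IsEvenMin (x : Bool) : List Bool → Prop
  | [] => False
  | [_] => False
  | z :: t :: w => z = x ∧ ((t = x ∧ IsEvenMin x (t :: w)) ∨
      (t = (!x) ∧ (w = [] ∨ IsOddMin (!x) w ∨ IsEvenMin x w)))

theorem IsOddMin.eq_head {x z : Bool} {w : List Bool} (h : IsOddMin x (z :: w)) : z = x := by
  cases w with
  | nil => exact h
  | cons t w => exact h.1

theorem IsEvenMin.eq_head {x z : Bool} {w : List Bool} (h : IsEvenMin x (z :: w)) : z = x := by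
  cases w with
  | nil => exact h.elim
  | cons t w => exact h.1

theorem isOddMin_cons_same (x : Bool) (w : List Bool) :
    IsOddMin x (x :: x :: w) ↔ IsOddMin x (x :: w) := by
  simp [IsOddMin]

theorem isOddMin_cons_not (x : Bool) (w : List Bool) :
    IsOddMin x (x :: (!x) :: w) ↔ IsOddMin x w := by
  simp [IsOddMin]

theorem isEvenMin_cons_same (x : Bool) (w : List Bool) :
    IsEvenMin x (x :: x :: w) ↔ IsEvenMin x (x :: w) := by
  simp [IsEvenMin]

theorem isEvenMin_cons_not (x : Bool) (w : List Bool) :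
    IsEvenMin x (x :: (!x) :: w) ↔ w = [] ∨ IsOddMin (!x) w ∨ IsEvenMin x w := by
  simp [IsEvenMin]

theorem IsOddMin.odd_ext {x : Bool} {v : List Bool} (h : IsOddMin x v) : Odd (ext v) := by
  induction v using word_induction with
  | nil => exact h.elim
  | single z => simp [ext_singleton]
  | same z w ih =>
    obtain rfl := h.eq_head
    rw [ext_cons_same]
    exact ih ((isOddMin_cons_same _ _).1 h)
  | diff z w ih =>
    obtain rfl := h.eq_head
    have hw := (isOddMin_cons_not _ _).1 h
    cases w with
    | nil => exact hw.elim
    | cons t w =>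
      obtain rfl := hw.eq_head
      rw [ext_cons_not_cons]
      exact (ih hw).add_even even_two

theorem IsEvenMin.even_ext {x : Bool} {v : List Bool} (h : IsEvenMin x v) : Even (ext v) := by
  induction v using word_induction with
  | nil => exact h.elim
  | single z => exact h.elim
  | same z w ih =>
    obtain rfl := h.eq_head
    rw [ext_cons_same]
    exact ih ((isEvenMin_cons_same _ _).1 h)
  | diff z w ih =>
    obtain rfl := h.eq_head
    rcases (isEvenMin_cons_not _ _).1 h with rfl | hw | hw
    · rw [ext_cons_not, ext_singleton]
      exact even_two
    · cases w with
      | nil => exact hw.elim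
      | cons t w =>
        obtain rfl := hw.eq_head
        rw [ext_cons_not_not_cons]
        exact hw.odd_ext.add_one
    · cases w with
      | nil => exact hw.elim
      | cons t w =>
        obtain rfl := hw.eq_head
        rw [ext_cons_not_cons]
        exact (ih hw).add even_two

theorem ext_le_height (v : List Bool) : ext v / 2 + 1 ≤ height v := by
  induction v using word_induction with
  | nil => simp [height_nil, ext_nil]
  | single x => simp [height_singleton, ext_singleton]
  | same x w ih => rwa [height_cons_same, ext_cons_same]
  | diff x w ih =>
    rw [height_cons_not]
    cases w with
    | nil => simp [height_nil, ext_cons_not, ext_singleton]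
    | cons t w =>
      rcases Bool.eq_or_eq_not t x with rfl | rfl
      · rw [ext_cons_not_cons]
        omega
      · rw [ext_cons_not_not_cons]
        omega

theorem exists_isOddMin_or_isEvenMin_cons_iff (x : Bool) (w : List Bool) :
    (∃ z, IsOddMin z (x :: w) ∨ IsEvenMin z (x :: w)) ↔
      IsOddMin x (x :: w) ∨ IsEvenMin x (x :: w) := by
  constructor
  · rintro ⟨z, h | h⟩
    · obtain rfl := h.eq_head
      exact Or.inl h
    · obtain rfl := h.eq_head
      exact Or.inr h
  · exact fun h => ⟨x, h⟩

theorem height_eq_ext_iff (v : List Bool) :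
    height v = ext v / 2 + 1 ↔ v = [] ∨ ∃ x, IsOddMin x v ∨ IsEvenMin x v := by
  induction v using word_induction with
  | nil => simp [height_nil, ext_nil]
  | single x => simp [height_singleton, ext_singleton, IsOddMin]
  | same x w ih =>
    rw [height_cons_same, ext_cons_same, ih, exists_isOddMin_or_isEvenMin_cons_iff,
      exists_isOddMin_or_isEvenMin_cons_iff, isOddMin_cons_same, isEvenMin_cons_same]
    simp
  | diff x w ih =>
    rw [exists_isOddMin_or_isEvenMin_cons_iff, isOddMin_cons_not, isEvenMin_cons_not,
      height_cons_not]
    cases w with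
    | nil => simp [height_nil, ext_cons_not, ext_singleton]
    | cons t w =>
      have hle := ext_le_height (t :: w)
      rw [exists_isOddMin_or_isEvenMin_cons_iff] at ih
      simp only [reduceCtorEq, false_or] at ih ⊢
      rcases Bool.eq_or_eq_not t x with rfl | rfl
      · have hodd : ¬ IsOddMin (!t) (t :: w) := fun h => absurd h.eq_head (by simp)
        rw [ext_cons_not_cons, Nat.add_div_right _ two_pos, Nat.add_right_cancel_iff, ih]
        simp [hodd]
      · have hodd : ¬ IsOddMin x ((!x) :: w) := fun h => absurd h.eq_head (by simp)
        have heven : ¬ IsEvenMin x ((!x) :: w) := fun h => absurd h.eq_head (by simp)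
        simp only [hodd, heven, false_or, or_false]
        rw [ext_cons_not_not_cons]
        constructor
        · intro h
          rcases ih.1 (by omega) with h' | h'
          · exact h'
          · have := Nat.even_iff.1 h'.even_ext
            omega
        · intro h
          have := Nat.odd_iff.1 h.odd_ext
          have := ih.2 (Or.inl h)
          omega

theorem powPos_singleton (x : Bool) : PowPos x [x] := ⟨1, one_pos, rfl⟩

theorem PowPos.cons {x : Bool} {p : List Bool} (h : PowPos x p) : PowPos x (x :: p) := by
  obtain ⟨k, -, rfl⟩ := h
  exact ⟨k + 1, by simp, rfl⟩

theorem PowPos.induction {x : Bool} {P : List Bool → Prop} (single : P [x])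
    (cons : ∀ p, P p → P (x :: p)) {p : List Bool} (h : PowPos x p) : P p := by
  obtain ⟨k, hk, rfl⟩ := h
  induction k, hk using Nat.le_induction with
  | base => exact single
  | succ k hk ih => exact cons _ ih

theorem IsOddMin.cons {x : Bool} {v : List Bool} (h : IsOddMin x v) : IsOddMin x (x :: v) := by
  cases v with
  | nil => exact h.elim
  | cons t w =>
    obtain rfl := h.eq_head
    exact (isOddMin_cons_same _ _).2 h

theorem IsEvenMin.cons {x : Bool} {v : List Bool} (h : IsEvenMin x v) :
    IsEvenMin x (x :: v) := by
  cases v with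
  | nil => exact h.elim
  | cons t w =>
    obtain rfl := h.eq_head
    exact (isEvenMin_cons_same _ _).2 h

theorem PowPos.isOddMin_append {x : Bool} {p v : List Bool} (hp : PowPos x p)
    (hv : IsOddMin x (x :: v)) : IsOddMin x (p ++ v) :=
  PowPos.induction (P := fun p => IsOddMin x (p ++ v)) hv (fun _ ih => ih.cons) hp

theorem PowPos.isEvenMin_append {x : Bool} {p v : List Bool} (hp : PowPos x p)
    (hv : IsEvenMin x (x :: v)) : IsEvenMin x (p ++ v) :=
  PowPos.induction (P := fun p => IsEvenMin x (p ++ v)) hv (fun _ ih => ih.cons) hp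

theorem isOddMin_iff (x : Bool) (v : List Bool) :
    IsOddMin x v ↔ ∃ (p : List Bool) (l : List (List Bool)),
      PowPos x p ∧ (∀ s ∈ l, ∃ q, PowPos x q ∧ s = (!x) :: q) ∧ v = p ++ l.flatten := by
  constructor
  · intro h
    induction v using word_induction with
    | nil => exact h.elim
    | single z =>
      obtain rfl := h.eq_head
      exact ⟨[z], [], powPos_singleton z, by simp, by simp⟩
    | same z w ih =>
      obtain rfl := h.eq_head
      obtain ⟨p, l, hp, hl, e⟩ := ih ((isOddMin_cons_same _ _).1 h)
      exact ⟨z :: p, l, hp.cons, hl, by rw [e]; rfl⟩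
    | diff z w ih =>
      obtain rfl := h.eq_head
      obtain ⟨p, l, hp, hl, rfl⟩ := ih ((isOddMin_cons_not _ _).1 h)
      refine ⟨[z], ((!z) :: p) :: l, powPos_singleton z, ?_, by simp⟩
      simpa using ⟨hp, hl⟩
  · rintro ⟨p, l, hp, hl, rfl⟩
    induction l generalizing p with
    | nil => exact hp.isOddMin_append rfl
    | cons s l ih =>
      obtain ⟨q, hq, rfl⟩ := hl s List.mem_cons_self
      refine hp.isOddMin_append ?_
      exact (isOddMin_cons_not _ _).2
        (ih q hq fun s hs => hl s (List.mem_cons_of_mem _ hs))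

/-- The rewriting `x⁺(y x⁺)^* = (x⁺ y)^* x⁺`. -/
theorem isOddMin_iff_right (x : Bool) (v : List Bool) :
    IsOddMin x v ↔ ∃ (l : List (List Bool)) (s : List Bool),
      (∀ t ∈ l, ∃ q, PowPos x q ∧ t = q ++ [!x]) ∧ PowPos x s ∧ v = l.flatten ++ s := by
  constructor
  · intro h
    induction v using word_induction with
    | nil => exact h.elim
    | single z =>
      obtain rfl := h.eq_head
      exact ⟨[], [z], by simp, powPos_singleton z, by simp⟩
    | same z w ih =>
      obtain rfl := h.eq_head
      obtain ⟨l, s, hl, hs, e⟩ := ih ((isOddMin_cons_same _ _).1 h)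
      rw [e]
      cases l with
      | nil => exact ⟨[], z :: s, by simp, hs.cons, rfl⟩
      | cons t l =>
        obtain ⟨⟨q, hq, rfl⟩, hrest⟩ := List.forall_mem_cons.1 hl
        exact ⟨((z :: q) ++ [!z]) :: l, s, List.forall_mem_cons.2 ⟨⟨_, hq.cons, rfl⟩, hrest⟩,
          hs, rfl⟩
    | diff z w ih =>
      obtain rfl := h.eq_head
      obtain ⟨l, s, hl, hs, rfl⟩ := ih ((isOddMin_cons_not _ _).1 h)
      exact ⟨([z] ++ [!z]) :: l, s,
        List.forall_mem_cons.2 ⟨⟨_, powPos_singleton z, rfl⟩, hl⟩, hs, rfl⟩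
  · rintro ⟨l, s, hl, hs, rfl⟩
    induction l with
    | nil => simpa using hs.isOddMin_append (v := []) rfl
    | cons t l ih =>
      obtain ⟨⟨q, hq, rfl⟩, hrest⟩ := List.forall_mem_cons.1 hl
      have := hq.isOddMin_append ((isOddMin_cons_not _ _).2 (ih hrest))
      simpa using this

theorem IsOddMin.isEvenMin_cons {x : Bool} {v : List Bool} (h : IsOddMin (!x) v) :
    IsEvenMin x (x :: v) := by
  induction v using word_induction with
  | nil => exact h.elim
  | single z =>
    obtain rfl := h.eq_head
    exact (isEvenMin_cons_not _ _).2 (Or.inl rfl)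
  | same z w ih =>
    obtain rfl := h.eq_head
    exact (isEvenMin_cons_not _ _).2 (Or.inr (Or.inl ((isOddMin_cons_same _ _).1 h)))
  | diff z w ih =>
    obtain rfl := h.eq_head
    have hw := ih ((isOddMin_cons_not _ _).1 h)
    rw [Bool.not_not]
    exact (isEvenMin_cons_not _ _).2 (Or.inr (Or.inr hw))

theorem isEvenMin_iff (x : Bool) (v : List Bool) :
    IsEvenMin x v ↔ ∃ (p : List Bool) (l l' : List (List Bool)) (s : List Bool),
      PowPos x p ∧
      (∀ t ∈ l, ∃ q, PowPos x q ∧ t = (!x) :: q) ∧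
      (∀ t ∈ l', ∃ q, PowPos (!x) q ∧ t = q ++ [x]) ∧
      PowPos (!x) s ∧
      v = p ++ l.flatten ++ l'.flatten ++ s := by
  constructor
  · intro h
    induction v using word_induction with
    | nil => exact h.elim
    | single z => exact h.elim
    | same z w ih =>
      obtain rfl := h.eq_head
      obtain ⟨p, l, l', s, hp, hl, hl', hs, e⟩ := ih ((isEvenMin_cons_same _ _).1 h)
      exact ⟨z :: p, l, l', s, hp.cons, hl, hl', hs, by rw [e]; rfl⟩
    | diff z w ih =>
      obtain rfl := h.eq_head
      rcases (isEvenMin_cons_not _ _).1 h with rfl | hw | hw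
      · exact ⟨[z], [], [], [!z], powPos_singleton z, by simp, by simp, powPos_singleton _, rfl⟩
      · obtain ⟨l', s, hl', hs, e⟩ := (isOddMin_iff_right _ _).1 hw.cons
        rw [Bool.not_not] at hl'
        exact ⟨[z], [], l', s, powPos_singleton z, by simp, hl', hs, by rw [e]; simp⟩
      · obtain ⟨p, l, l', s, hp, hl, hl', hs, rfl⟩ := ih hw
        exact ⟨[z], ((!z) :: p) :: l, l', s, powPos_singleton z,
          List.forall_mem_cons.2 ⟨⟨p, hp, rfl⟩, hl⟩, hl', hs, by simp⟩
  · rintro ⟨p, l, l', s, hp, hl, hl', hs, rfl⟩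
    induction l generalizing p with
    | nil =>
      have hodd : IsOddMin (!x) (l'.flatten ++ s) :=
        (isOddMin_iff_right _ _).2 ⟨l', s, by rwa [Bool.not_not], hs, rfl⟩
      simpa using hp.isEvenMin_append hodd.isEvenMin_cons
    | cons t l ih =>
      obtain ⟨⟨q, hq, rfl⟩, hrest⟩ := List.forall_mem_cons.1 hl
      have := hp.isEvenMin_append
        ((isEvenMin_cons_not _ _).2 (Or.inr (Or.inr (ih q hq hrest))))
      simpa using this

/-- ⌊ext(v)/2⌋ + 1 ≤ h(v) ≤ ⌊|v|/2⌋ + 1, with characterization of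
the words attaining each bound. -/
theorem height_bounds (v : List Bool) :
    (ext v / 2 + 1 ≤ height v ∧ height v ≤ v.length / 2 + 1) ∧
    (height v = v.length / 2 + 1 ↔
      ∃ p q r, InStar ({[false, true], [true, false]} : Set (List Bool)) p ∧
        InStar ({[false, true], [true, false]} : Set (List Bool)) r ∧
        (q = [] ∨ q = [false] ∨ q = [true]) ∧ v = p ++ q ++ r) ∧
    (height v = ext v / 2 + 1 ↔
      ∃ x : Bool,
        (Odd (ext v) ∧
          ∃ (p : List Bool) (l : List (List Bool)),
            PowPos x p ∧ (∀ s ∈ l, ∃ q, PowPos x q ∧ s = (!x) :: q) ∧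
            v = p ++ l.flatten) ∨
        (Even (ext v) ∧
          (v = [] ∨
            ∃ (p : List Bool) (l l' : List (List Bool)) (s : List Bool),
              PowPos x p ∧
              (∀ t ∈ l, ∃ q, PowPos x q ∧ t = (!x) :: q) ∧
              (∀ t ∈ l', ∃ q, PowPos (!x) q ∧ t = q ++ [x]) ∧
              PowPos (!x) s ∧
              v = p ++ l.flatten ++ l'.flatten ++ s))) := by
  refine ⟨⟨ext_le_height v, height_le_length v⟩, ?_, ?_⟩
  · rw [height_eq_length_iff_isHeightMax, exists_factorization_iff_isHeightMax]
  · simp only [← isOddMin_iff, ← isEvenMin_iff]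
    rw [height_eq_ext_iff]
    constructor
    · rintro (rfl | ⟨x, h | h⟩)
      · exact ⟨false, Or.inr ⟨by simp [ext_nil], Or.inl rfl⟩⟩
      · exact ⟨x, Or.inl ⟨h.odd_ext, h⟩⟩
      · exact ⟨x, Or.inr ⟨h.even_ext, Or.inr h⟩⟩
    · rintro ⟨x, ⟨-, h⟩ | ⟨-, h | h⟩⟩
      · exact Or.inr ⟨x, Or.inl h⟩
      · exact Or.inl h
      · exact Or.inr ⟨x, Or.inr h⟩

end Chri
end
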